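/- Let f₀, f₁ ∈ C^∞(ℝⁿ,ℝⁿ) with f₀(0) = 0. Set H₀ := f₀'(0), b := f₁(0), H₁ := f₁'(0), Q₀ := ½ f₀''(0), bₖ := (−H₀)ᵏ b, L₀ := H₁ and L_{k+1} := Lₖ H₀ − H₀ Lₖ − 2 Q₀(bₖ, ·). Then for every k ∈ ℕ one has ad^k_{f₀}(f₁)(0) = bₖ and, more precisely, ad^k_{f₀}(f₁) ≡₂ (x ↦ bₖ + Lₖ x), i.e. there is a smooth map θ from ℝⁿ to symmetric bilinear maps ℝⁿ×ℝⁿ → ℝⁿ with ad^k_{f₀}(f₁)(x) = bₖ + Lₖ x + θ(x)[x,x]. Consequently [ad^k_{f₀}(f₁), ad^j_{f₀}(f₁)](0) = Lⱼ bₖ − Lₖ bⱼ for all j, k ∈ ℕ. -/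

import Mathlib

noncomputable section

/-- `ℝⁿ` with its Euclidean structure. -/
abbrev Euc (n : ℕ) := EuclideanSpace ℝ (Fin n)

/-- The Lie bracket of vector fields: `[X,Y](x) := Y'(x)·X(x) − X'(x)·Y(x)`. -/
def lieB {n : ℕ} (X Y : Euc n → Euc n) : Euc n → Euc n :=
  fun x => fderiv ℝ Y x (X x) - fderiv ℝ X x (Y x)

/-- Iterated adjoint: `ad⁰_X(Y) := Y`, `ad^{k+1}_X(Y) := [X, ad^k_X(Y)]`. -/
def adk {n : ℕ} (X Y : Euc n → Euc n) : ℕ → (Euc n → Euc n)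
  | 0 => Y
  | k+1 => lieB X (adk X Y k)

/-- `φ ≡ₘ ψ` (equality modulo `m`-th order terms): there exists a smooth map `θ`
from `ℝⁿ` to the space of symmetric `m`-multilinear maps `(ℝⁿ)ᵐ → ℝⁿ` such that
`φ(x) = ψ(x) + θ(x)[x,…,x]` for all `x`. -/
def EqMod {n : ℕ} (m : ℕ) (φ ψ : Euc n → Euc n) : Prop :=
  ∃ θ : Euc n → ContinuousMultilinearMap ℝ (fun _ : Fin m => Euc n) (Euc n),
    ContDiff ℝ (⊤ : ℕ∞) θ ∧
    (∀ x : Euc n, ∀ v : Fin m → Euc n, ∀ σ : Equiv.Perm (Fin m),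
      θ x (v ∘ σ) = θ x v) ∧
    ∀ x : Euc n, φ x = ψ x + θ x (fun _ => x)

/-- `H₀ := f₀'(0)`. -/
def H0a {n : ℕ} (f₀ : Euc n → Euc n) : Euc n →L[ℝ] Euc n := fderiv ℝ f₀ 0

/-- `H₁ := f₁'(0)`. -/
def H1a {n : ℕ} (f₁ : Euc n → Euc n) : Euc n →L[ℝ] Euc n := fderiv ℝ f₁ 0

/-- `Q₀ := ½ f₀''(0)`, as a (symmetric) bilinear map `ℝⁿ × ℝⁿ → ℝⁿ`. -/
def Q0a {n : ℕ} (f₀ : Euc n → Euc n) : Euc n →L[ℝ] Euc n →L[ℝ] Euc n :=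
  (1/2 : ℝ) • fderiv ℝ (fun x => fderiv ℝ f₀ x) 0

/-- `bₖ := (−H₀)ᵏ b` where `b := f₁(0)`. -/
def bka {n : ℕ} (f₀ f₁ : Euc n → Euc n) (k : ℕ) : Euc n := ((-H0a f₀) ^ k) (f₁ 0)

/-- `L₀ := H₁`, `L_{k+1} := Lₖ H₀ − H₀ Lₖ − 2 Q₀(bₖ, ·)`. -/
def Lka {n : ℕ} (f₀ f₁ : Euc n → Euc n) : ℕ → (Euc n →L[ℝ] Euc n)
  | 0 => H1a f₁
  | k+1 => (Lka f₀ f₁ k).comp (H0a f₀) - (H0a f₀).comp (Lka f₀ f₁ k)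
      - (2:ℝ) • (Q0a f₀ (bka f₀ f₁ k))

open MeasureTheory intervalIntegral in
/-- Differentiation under an interval integral depending continuously differentiably on a
parameter. -/
theorem hasFDerivAt_intervalIntegral_of_contDiff {E F : Type*}
    [NormedAddCommGroup E] [NormedSpace ℝ E] [ProperSpace E]
    [NormedAddCommGroup F] [NormedSpace ℝ F] {g : E × ℝ → F} (hg : ContDiff ℝ 1 g)
    (a b : ℝ) (x₀ : E) :
    HasFDerivAt (fun x => ∫ t in a..b, g (x, t))
      (∫ t in a..b, (fderiv ℝ g (x₀, t)).comp (ContinuousLinearMap.inl ℝ E ℝ)) x₀ := by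
  have hg' : Continuous fun p : E × ℝ =>
      (fderiv ℝ g p).comp (ContinuousLinearMap.inl ℝ E ℝ) :=
    (hg.continuous_fderiv one_ne_zero).clm_comp continuous_const
  obtain ⟨C, hC⟩ := ((isCompact_closedBall x₀ 1).prod (isCompact_uIcc (a := a) (b := b))
    ).exists_bound_of_continuousOn hg'.continuousOn
  refine hasFDerivAt_integral_of_dominated_of_fderiv_le (bound := fun _ => C)
    (F' := fun x t => (fderiv ℝ g (x, t)).comp (ContinuousLinearMap.inl ℝ E ℝ))
    (Metric.closedBall_mem_nhds x₀ one_pos) ?_ ?_ ?_ ?_ intervalIntegrable_const ?_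
  · exact .of_forall fun x =>
      (hg.continuous.comp (Continuous.prodMk_right x)).aestronglyMeasurable
  · exact (hg.continuous.comp (Continuous.prodMk_right x₀)).intervalIntegrable _ _
  · exact (hg'.comp (Continuous.prodMk_right x₀)).aestronglyMeasurable
  · exact .of_forall fun t ht x hx => hC (x, t) ⟨hx, Set.uIoc_subset_uIcc ht⟩
  · exact .of_forall fun t _ x _ =>
      ((hg.differentiable one_ne_zero (x, t)).hasFDerivAt).comp x (hasFDerivAt_prodMk_left x t)

universe u

/-- The integral over a compact interval of a `C^k` function is `C^k` in the parameter. -/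
theorem contDiff_intervalIntegral_nat {E : Type u}
    [NormedAddCommGroup E] [NormedSpace ℝ E] [ProperSpace E] (a b : ℝ) (k : ℕ) :
    ∀ {F : Type u} [NormedAddCommGroup F] [NormedSpace ℝ F] {g : E × ℝ → F},
      ContDiff ℝ k g → ContDiff ℝ k fun x => ∫ t in a..b, g (x, t) := by
  induction k with
  | zero =>
    intro F _ _ g hg
    simp only [Nat.cast_zero, contDiff_zero] at hg ⊢
    exact intervalIntegral.continuous_parametric_intervalIntegral_of_continuous'
      (f := fun x t => g (x, t)) hg a b
  | succ k ih =>
    intro F _ _ g hg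
    have hg1 : ContDiff ℝ 1 g := hg.of_le (by norm_cast; omega)
    rw [Nat.cast_succ, contDiff_succ_iff_hasFDerivAt]
    exact ⟨_, ih ((hg.fderiv_right (by norm_cast)).clm_comp contDiff_const),
      hasFDerivAt_intervalIntegral_of_contDiff hg1 a b⟩

/-- The integral over a compact interval of a smooth function is smooth in the parameter. -/
theorem contDiff_intervalIntegral {E F : Type u}
    [NormedAddCommGroup E] [NormedSpace ℝ E] [ProperSpace E]
    [NormedAddCommGroup F] [NormedSpace ℝ F] {g : E × ℝ → F}
    (hg : ContDiff ℝ (⊤ : ℕ∞) g) (a b : ℝ) :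
    ContDiff ℝ (⊤ : ℕ∞) fun x => ∫ t in a..b, g (x, t) :=
  contDiff_infty.2 fun k => contDiff_intervalIntegral_nat a b k (contDiff_infty.1 hg k)

/-- A smooth map agrees with its first-order Taylor polynomial at `0` modulo quadratic terms. -/
theorem eqMod_two_of_contDiff {n : ℕ} {φ : Euc n → Euc n} (hφ : ContDiff ℝ (⊤ : ℕ∞) φ) :
    EqMod 2 φ (fun x => φ 0 + fderiv ℝ φ 0 x) := by
  have hD : ContDiff ℝ (⊤ : ℕ∞) fun p : Euc n × ℝ =>
      (1 - p.2) • iteratedFDeriv ℝ 2 φ (p.2 • p.1) :=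
    (contDiff_const.sub contDiff_snd).smul
      ((hφ.iteratedFDeriv_right (i := 2) (m := (⊤ : ℕ∞)) (by norm_cast)).comp
        (contDiff_snd.smul contDiff_fst))
  have happ (x : Euc n) (v : Fin 2 → Euc n) :
      (∫ t in (0 : ℝ)..1, (1 - t) • iteratedFDeriv ℝ 2 φ (t • x)) v =
        ∫ t in (0 : ℝ)..1, (1 - t) • iteratedFDeriv ℝ 2 φ (t • x) v := by
    have hc := (hD.continuous.comp (Continuous.prodMk_right x)).intervalIntegrable
      (μ := MeasureTheory.volume) 0 1
    rw [intervalIntegral.integral_of_le zero_le_one, intervalIntegral.integral_of_le zero_le_one]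
    exact ContinuousMultilinearMap.integral_apply
      ((intervalIntegrable_iff_integrableOn_Ioc_of_le zero_le_one).1 hc) v
  refine ⟨fun x => ∫ t in (0 : ℝ)..1, (1 - t) • iteratedFDeriv ℝ 2 φ (t • x),
    contDiff_intervalIntegral hD 0 1, fun x v σ => ?_, fun x => ?_⟩
  · simp_rw [happ]
    congr! 3 with t
    have hsymm : IsSymmSndFDerivAt ℝ φ (t • x) :=
      (contDiff_infty.1 hφ 2).contDiffAt.isSymmSndFDerivAt (by simp)
    rw [iteratedFDeriv_two_apply, iteratedFDeriv_two_apply]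
    have hσ : σ 0 ≠ σ 1 := σ.injective.ne (by decide)
    obtain ⟨h0, h1⟩ | ⟨h0, h1⟩ : σ 0 = 0 ∧ σ 1 = 1 ∨ σ 0 = 1 ∧ σ 1 = 0 := by omega
    · simp [h0, h1]
    · simp [h0, h1, hsymm.eq (v 0) (v 1)]
  · have := map_add_eq_sum_add_integral_iteratedFDeriv (f := φ) (x := 0) (y := x) (n := 1)
      fun t _ => (hφ.of_le (by norm_cast)).contDiffAt
    simpa [happ, Finset.sum_range_succ] using this

theorem ContDiff.lieB {n : ℕ} {X Y : Euc n → Euc n} (hX : ContDiff ℝ (⊤ : ℕ∞) X)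
    (hY : ContDiff ℝ (⊤ : ℕ∞) Y) : ContDiff ℝ (⊤ : ℕ∞) (lieB X Y) :=
  ((hY.fderiv_right (by simp)).clm_apply hX).sub ((hX.fderiv_right (by simp)).clm_apply hY)

theorem ContDiff.adk {n : ℕ} {X Y : Euc n → Euc n} (hX : ContDiff ℝ (⊤ : ℕ∞) X)
    (hY : ContDiff ℝ (⊤ : ℕ∞) Y) (k : ℕ) : ContDiff ℝ (⊤ : ℕ∞) (adk X Y k) := by
  induction k with
  | zero => exact hY
  | succ k ih => exact hX.lieB ih

theorem lieB_zero_of_apply_zero {n : ℕ} {X : Euc n → Euc n} (Y : Euc n → Euc n) (hX0 : X 0 = 0) :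
    lieB X Y 0 = -fderiv ℝ X 0 (Y 0) := by
  simp [lieB, hX0]

/-- The linearization of `[X, Y]` at a zero of `X`. -/
theorem fderiv_lieB_zero {n : ℕ} {X Y : Euc n → Euc n} (hX : ContDiff ℝ (⊤ : ℕ∞) X)
    (hY : ContDiff ℝ (⊤ : ℕ∞) Y) (hX0 : X 0 = 0) :
    fderiv ℝ (lieB X Y) 0 = (fderiv ℝ Y 0).comp (fderiv ℝ X 0) -
      (fderiv ℝ X 0).comp (fderiv ℝ Y 0) - fderiv ℝ (fderiv ℝ X) 0 (Y 0) := by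
  have hd {Z : Euc n → Euc n} (hZ : ContDiff ℝ (⊤ : ℕ∞) Z) : HasFDerivAt Z (fderiv ℝ Z 0) 0 :=
    (hZ.differentiable (by simp) 0).hasFDerivAt
  have hdd {Z : Euc n → Euc n} (hZ : ContDiff ℝ (⊤ : ℕ∞) Z) :
      HasFDerivAt (fderiv ℝ Z) (fderiv ℝ (fderiv ℝ Z) 0) 0 :=
    (((hZ.fderiv_right (m := (⊤ : ℕ∞)) (by simp)).differentiable (by simp)) 0).hasFDerivAt
  have hsymm : IsSymmSndFDerivAt ℝ X 0 :=
    (contDiff_infty.1 hX 2).contDiffAt.isSymmSndFDerivAt (by simp)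
  have h := ((hdd hY).clm_apply (hd hX)).sub ((hdd hX).clm_apply (hd hY))
  refine h.fderiv.trans ?_
  ext1 v
  simp [hX0, hsymm.eq (Y 0) v]
  abel

theorem adk_apply_zero {n : ℕ} {f₀ : Euc n → Euc n} (f₁ : Euc n → Euc n) (hf00 : f₀ 0 = 0)
    (k : ℕ) : adk f₀ f₁ k 0 = bka f₀ f₁ k := by
  induction k with
  | zero => simp [adk, bka]
  | succ k ih =>
    rw [adk, lieB_zero_of_apply_zero _ hf00, ih]
    simp [bka, pow_succ', H0a]

theorem fderiv_adk_zero {n : ℕ} {f₀ f₁ : Euc n → Euc n} (hf₀ : ContDiff ℝ (⊤ : ℕ∞) f₀)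
    (hf₁ : ContDiff ℝ (⊤ : ℕ∞) f₁) (hf00 : f₀ 0 = 0) (k : ℕ) :
    fderiv ℝ (adk f₀ f₁ k) 0 = Lka f₀ f₁ k := by
  induction k with
  | zero => rfl
  | succ k ih =>
    rw [adk, fderiv_lieB_zero hf₀ (hf₀.adk hf₁ k) hf00, ih, adk_apply_zero f₁ hf00]
    simp [Lka, Q0a, H0a, smul_smul]

/-- For smooth `f₀, f₁` with `f₀(0) = 0`: `ad^k_{f₀}(f₁)(0) = bₖ`, more precisely
`ad^k_{f₀}(f₁) ≡₂ (x ↦ bₖ + Lₖ x)`; consequently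
`[ad^k_{f₀}(f₁), ad^j_{f₀}(f₁)](0) = Lⱼ bₖ − Lₖ bⱼ` for all `j, k`. -/
theorem statement11
    (n : ℕ) (hn : 0 < n) (f₀ f₁ : Euc n → Euc n)
    (hf₀ : ContDiff ℝ (⊤ : ℕ∞) f₀) (hf₁ : ContDiff ℝ (⊤ : ℕ∞) f₁)
    (hf00 : f₀ 0 = 0) :
    (∀ k : ℕ, adk f₀ f₁ k 0 = bka f₀ f₁ k) ∧
    (∀ k : ℕ, EqMod 2 (adk f₀ f₁ k) (fun x => bka f₀ f₁ k + Lka f₀ f₁ k x)) ∧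
    (∀ j k : ℕ, lieB (adk f₀ f₁ k) (adk f₀ f₁ j) 0 =
      Lka f₀ f₁ j (bka f₀ f₁ k) - Lka f₀ f₁ k (bka f₀ f₁ j)) := by
  have hb := adk_apply_zero f₁ hf00
  have hL := fderiv_adk_zero hf₀ hf₁ hf00
  refine ⟨hb, fun k => ?_, fun j k => ?_⟩
  · rw [← hb, ← hL]
    exact eqMod_two_of_contDiff (hf₀.adk hf₁ k)
  · rw [← hb, ← hb, ← hL, ← hL, lieB]
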